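/- Let f : ℝ^l → ℝ be a degree-d polynomial f(x) = Σ_{multisets S ⊆ [l], |S| ≤ d} c_S ∏_{i∈S} x_i, and let 𝒢 = (G_1,…,G_l) be a vector of l i.i.d. standard N(0,1) Gaussian random variables. Then for every multiset T ⊆ [l] with |T| ≤ d, one has (E[f(𝒢)²])^{1/2} ≥ d^{−d} · |c_T| / C(l+d, d), where C(l+d,d) is the binomial coefficient. -/

import Mathlib

open MeasureTheory ProbabilityTheory Real
open scoped ENNReal NNReal

/-- Evaluation of a polynomial given by its (finitely supported) coefficient
function on multisets of variable indices. -/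
noncomputable def polyEval {ι : Type*} (c : Multiset ι →₀ ℝ) (x : ι → ℝ) : ℝ :=
  ∑ S ∈ c.support, c S * (S.map x).prod

/-- Product of `l` independent standard Gaussians. -/
noncomputable def stdGaussianPi (l : ℕ) : Measure (Fin l → ℝ) :=
  Measure.pi fun _ => gaussianReal 0 1

open Polynomial in
noncomputable def gL (p : ℝ[X]) : ℝ := ∫ x, p.eval x ∂(gaussianReal 0 1)

open Polynomial in
noncomputable def He (n : ℕ) : ℝ[X] := (hermite n).map (Int.castRingHom ℝ)

open Polynomial in
theorem integrable_poly (p : ℝ[X]) : Integrable (fun x => p.eval x) (gaussianReal 0 1) := by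
  simp_rw [Polynomial.eval_eq_sum_range]
  refine integrable_finsetSum _ fun i _ => Integrable.const_mul ?_ _
  have h := (memLp_id_gaussianReal (μ := 0) (v := 1) (i : ℝ≥0)).integrable_norm_pow'
  refine h.mono (by fun_prop) ?_
  filter_upwards with x
  simp

open Polynomial in
theorem integrable_poly_pdf (p : ℝ[X]) :
    Integrable (fun x => p.eval x * gaussianPDFReal 0 1 x) := by
  have h := integrable_poly p
  rw [gaussianReal_of_var_ne_zero 0 one_ne_zero,
    integrable_withDensity_iff_integrable_smul' (measurable_gaussianPDF 0 1)
      (by filter_upwards with x; exact gaussianPDF_lt_top)] at h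
  refine h.congr ?_
  filter_upwards with x
  simp [mul_comm]

open Polynomial in
theorem gL_eq (p : ℝ[X]) : gL p = ∫ x, p.eval x * gaussianPDFReal 0 1 x := by
  rw [gL, integral_gaussianReal_eq_integral_smul one_ne_zero]
  simp [mul_comm]

open Polynomial in
theorem gL_add (p q : ℝ[X]) : gL (p + q) = gL p + gL q := by
  simp only [gL, eval_add]
  exact integral_add (integrable_poly p) (integrable_poly q)

open Polynomial in
theorem gL_sub (p q : ℝ[X]) : gL (p - q) = gL p - gL q := by
  simp only [gL, eval_sub]
  exact integral_sub (integrable_poly p) (integrable_poly q)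

open Polynomial in
theorem gL_C_mul (a : ℝ) (q : ℝ[X]) : gL (C a * q) = a * gL q := by
  simp only [gL, eval_mul, eval_C]
  exact integral_const_mul _ _

open Polynomial in
theorem gL_C (a : ℝ) : gL (C a) = a := by
  simp [gL]

open Polynomial in
theorem gL_stein (p : ℝ[X]) : gL (X * p) = gL (derivative p) := by
  have hd : ∀ x : ℝ, HasDerivAt (fun x => p.eval x * gaussianPDFReal 0 1 x)
      ((derivative p - X * p).eval x * gaussianPDFReal 0 1 x) x := by
    intro x
    have h1 : HasDerivAt (fun x : ℝ => gaussianPDFReal 0 1 x) (-x * gaussianPDFReal 0 1 x) x := by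
      simp only [gaussianPDFReal_def]
      have h2 : HasDerivAt (fun x : ℝ => -(x - 0) ^ 2 / (2 * ((1 : ℝ≥0) : ℝ))) (-x) x := by
        have h3 := ((((hasDerivAt_id x).sub_const 0).pow 2).neg).div_const (2 * ((1 : ℝ≥0) : ℝ))
        refine HasDerivAt.congr_deriv h3 ?_
        simp
        ring
      refine HasDerivAt.congr_deriv (h2.exp.const_mul ((√(2 * π * ((1 : ℝ≥0) : ℝ)))⁻¹)) ?_
      ring
    refine HasDerivAt.congr_deriv ((p.hasDerivAt x).mul h1) ?_
    simp only [eval_sub, eval_mul, eval_X]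
    ring
  have h := integral_eq_zero_of_hasDerivAt_of_integrable hd (integrable_poly_pdf _)
    (integrable_poly_pdf p)
  rw [← gL_eq, gL_sub] at h
  linarith

open Polynomial in
theorem He_succ (n : ℕ) : He (n + 1) = X * He n - derivative (He n) := by
  simp [He, hermite_succ, derivative_map]

open Polynomial in
theorem gL_He_succ (n : ℕ) (p : ℝ[X]) : gL (p * He (n + 1)) = gL (derivative p * He n) := by
  have h := gL_stein (p * He n)
  rw [derivative_mul, gL_add] at h
  rw [He_succ, mul_sub, gL_sub, ← add_sub_cancel_right (gL (derivative p * He n)) 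
    (gL (p * derivative (He n))), ← h]
  congr 2
  ring

open Polynomial in
theorem gL_He (n : ℕ) (p : ℝ[X]) : gL (p * He n) = gL (derivative^[n] p) := by
  induction n generalizing p with
  | zero => simp [He]
  | succ n ih => rw [gL_He_succ, ih, Function.iterate_succ_apply]

open Polynomial in
theorem gL_He_lt (n : ℕ) (p : ℝ[X]) (h : p.natDegree < n) : gL (p * He n) = 0 := by
  rw [gL_He, iterate_derivative_eq_zero h]
  simp [gL]

open Polynomial in
theorem gL_He_top (n : ℕ) (p : ℝ[X]) (h : p.natDegree ≤ n) :
    gL (p * He n) = p.coeff n * n.factorial := by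
  rw [gL_He]
  have h0 : derivative^[n] p = C (p.coeff n * n.factorial) := by
    ext k
    rw [coeff_iterate_derivative, coeff_C]
    split_ifs with hk
    · subst hk; simp [Nat.descFactorial_self, mul_comm]
    · rw [coeff_eq_zero_of_natDegree_lt (by omega)]; simp
  rw [h0, gL_C]

open Polynomial in
theorem natDegree_He (n : ℕ) : (He n).natDegree = n := by
  rw [He, (hermite_monic n).natDegree_map, natDegree_hermite]

open Polynomial in
theorem coeff_He_self (n : ℕ) : (He n).coeff n = 1 := by
  simp [He]

open Polynomial in
theorem gL_orth (m n : ℕ) : gL (He m * He n) = if m = n then (n.factorial : ℝ) else 0 := by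
  rcases lt_trichotomy m n with h | h | h
  · rw [gL_He_lt _ _ (by rwa [natDegree_He]), if_neg h.ne]
  · subst h
    rw [gL_He_top _ _ (by rw [natDegree_He]), coeff_He_self]; simp
  · rw [mul_comm, gL_He_lt _ _ (by rwa [natDegree_He]), if_neg h.ne']

open Polynomial in
theorem expand_He (N : ℕ) (p : ℝ[X]) (h : p.natDegree < N) :
    p = ∑ n ∈ Finset.range N, C (gL (p * He n) / n.factorial) * He n := by
  induction N generalizing p with
  | zero => omega
  | succ N ih =>
    rw [Finset.sum_range_succ, gL_He_top N p (by omega),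
      mul_div_cancel_right₀ _ (by positivity)]
    set q := p - C (p.coeff N) * He N with hq
    have hqp : p = q + C (p.coeff N) * He N := by rw [hq]; ring
    have hsum : ∑ n ∈ Finset.range N, C (gL (p * He n) / n.factorial) * He n
        = ∑ n ∈ Finset.range N, C (gL (q * He n) / n.factorial) * He n := by
      refine Finset.sum_congr rfl fun n hn => ?_
      have hn' := Finset.mem_range.1 hn
      have : gL (p * He n) = gL (q * He n) := by
        rw [hq, sub_mul, gL_sub, mul_assoc, gL_C_mul, gL_orth, if_neg (by omega)]; simp
      rw [this]
    rw [hsum]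
    by_cases hN : N = 0
    · subst hN
      have : p = C (p.coeff 0) := eq_C_of_natDegree_eq_zero (by omega)
      rw [this]; simp [He]
    · rw [← ih q ?_]
      · exact hqp
      · have hle : q.natDegree ≤ N := by
          refine (natDegree_sub_le _ _).trans (max_le (by omega) ?_)
          exact (natDegree_C_mul_le _ _).trans (natDegree_He N).le
        refine lt_of_le_of_ne hle fun he => ?_
        have hc : q.coeff N = 0 := by
          rw [hq, coeff_sub, coeff_C_mul, coeff_He_self]; ring
        rw [← he, coeff_natDegree, leadingCoeff_eq_zero] at hc
        rw [hc] at he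
        simp at he
        omega

open Polynomial in
theorem dual_one (d k r : ℕ) (hr : r ≤ d) :
    ∑ n ∈ Finset.range (d + 1), ((He n).coeff k / n.factorial) * gL ((X : ℝ[X]) ^ r * He n)
      = if k = r then 1 else 0 := by
  have h := congrArg (fun p => p.coeff k) (expand_He (d + 1) ((X : ℝ[X]) ^ r) (by simp; omega))
  simp only [coeff_X_pow, finsetSum_coeff, coeff_C_mul] at h
  rw [h]
  refine Finset.sum_congr rfl fun n _ => ?_
  ring

open Polynomial in
theorem coeff_He_le (n k : ℕ) : |(He n).coeff k| ≤ n.factorial := by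
  rw [He, coeff_map]
  have : |(hermite n).coeff k| ≤ (n.factorial : ℤ) := by
    rw [coeff_hermite]
    split_ifs with h
    · rw [abs_mul, abs_mul, abs_pow]
      simp only [abs_neg, abs_one, one_pow, one_mul, Nat.abs_cast]
      norm_cast
      rcases le_or_gt k n with hk | hk
      · have h1 := Nat.choose_mul_factorial_mul_factorial hk
        have h2 : (n - k - 1).doubleFactorial ≤ (n - k).factorial :=
          (Nat.doubleFactorial_le_factorial _).trans (Nat.factorial_le (by omega))
        calc _ ≤ (n - k).factorial * n.choose k := by gcongr
          _ ≤ (n - k).factorial * n.choose k * k.factorial :=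
            Nat.le_mul_of_pos_right _ (Nat.factorial_pos k)
          _ = n.factorial := by rw [← h1]; ring
      · simp [Nat.choose_eq_zero_of_lt hk]
    · simp
  simp only [eq_intCast]
  exact_mod_cast this

open Polynomial in
/-- Product of one-variable polynomials in separate variables. -/
noncomputable def PP {l : ℕ} (p : Fin l → ℝ[X]) (x : Fin l → ℝ) : ℝ := ∏ i, (p i).eval (x i)

open Polynomial in
theorem integrable_PP {l : ℕ} (p : Fin l → ℝ[X]) : Integrable (PP p) (stdGaussianPi l) :=
  Integrable.fintype_prod (f := fun i x => (p i).eval x) fun i => integrable_poly (p i)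

open Polynomial in
theorem integral_PP {l : ℕ} (p : Fin l → ℝ[X]) :
    ∫ x, PP p x ∂(stdGaussianPi l) = ∏ i, gL (p i) :=
  integral_fintype_prod_eq_prod (fun i x => (p i).eval x)

open Polynomial in
theorem sum_mul_sum_PP {l : ℕ} {α β : Type*} (s : Finset α) (t : Finset β) (a : α → ℝ) (b : β → ℝ)
    (p : α → Fin l → ℝ[X]) (q : β → Fin l → ℝ[X]) (x : Fin l → ℝ) :
    (∑ j ∈ s, a j * PP (p j) x) * (∑ k ∈ t, b k * PP (q k) x) =
      ∑ j ∈ s, ∑ k ∈ t, (a j * b k) * PP (fun i => p j i * q k i) x := by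
  rw [Finset.sum_mul_sum]
  refine Finset.sum_congr rfl fun j _ => Finset.sum_congr rfl fun k _ => ?_
  simp only [PP, eval_mul, Finset.prod_mul_distrib]
  ring

open Polynomial in
theorem integrable_sum_mul_sum {l : ℕ} {α β : Type*} (s : Finset α) (t : Finset β) (a : α → ℝ)
    (b : β → ℝ) (p : α → Fin l → ℝ[X]) (q : β → Fin l → ℝ[X]) :
    Integrable (fun x => (∑ j ∈ s, a j * PP (p j) x) * (∑ k ∈ t, b k * PP (q k) x))
      (stdGaussianPi l) := by
  simp_rw [sum_mul_sum_PP]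
  exact integrable_finsetSum _ fun j _ => integrable_finsetSum _ fun k _ =>
    (integrable_PP _).const_mul _

open Polynomial in
theorem integral_sum_mul_sum {l : ℕ} {α β : Type*} (s : Finset α) (t : Finset β) (a : α → ℝ)
    (b : β → ℝ) (p : α → Fin l → ℝ[X]) (q : β → Fin l → ℝ[X]) :
    ∫ x, (∑ j ∈ s, a j * PP (p j) x) * (∑ k ∈ t, b k * PP (q k) x) ∂(stdGaussianPi l) =
      ∑ j ∈ s, ∑ k ∈ t, (a j * b k) * ∏ i, gL (p j i * q k i) := by
  simp_rw [sum_mul_sum_PP]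
  rw [integral_finsetSum _ fun j _ => integrable_finsetSum _ fun k _ =>
    (integrable_PP _).const_mul _]
  refine Finset.sum_congr rfl fun j _ => ?_
  rw [integral_finsetSum _ fun k _ => (integrable_PP _).const_mul _]
  refine Finset.sum_congr rfl fun k _ => ?_
  rw [integral_const_mul, integral_PP]

/-- Exponent vectors of total degree at most `d`. -/
def expSet (l d : ℕ) : Finset (Fin l → ℕ) :=
  (Fintype.piFinset fun _ : Fin l => Finset.range (d + 1)).filter fun n => ∑ i, n i ≤ d

theorem card_expSet (l d : ℕ) : (expSet l d).card ≤ (l + d).choose d := by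
  have h : Fintype.card (Sym (Option (Fin l)) d) = (l + d).choose d := by
    rw [Sym.card_sym_eq_choose]
    simp only [Fintype.card_option, Fintype.card_fin]
    congr 1
    omega
  rw [← h, ← Finset.card_univ]
  refine Finset.card_le_card_of_surjOn
    (fun σ i => Multiset.count (some i) (σ : Multiset (Option (Fin l)))) ?_
  intro n hn
  have hn' : ∑ i, n i ≤ d := by
    have := Finset.mem_coe.1 hn
    exact (Finset.mem_filter.1 this).2
  refine ⟨⟨(∑ i, Multiset.replicate (n i) (some i)) + Multiset.replicate (d - ∑ i, n i) none, ?_⟩,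
    Finset.mem_coe.2 (Finset.mem_univ _), ?_⟩
  · simp only [Multiset.card_add, Multiset.card_sum, Multiset.card_replicate]
    omega
  · funext i
    simp [Multiset.count_sum', Multiset.count_replicate]

open Polynomial in
theorem dual_multi (l d : ℕ) (t r : Fin l → ℕ) (hr : ∑ i, r i ≤ d) :
    ∑ n ∈ expSet l d, (∏ i, (He (n i)).coeff (t i) / (n i).factorial) *
      ∏ i, gL ((X : ℝ[X]) ^ (r i) * He (n i)) = if t = r then 1 else 0 := by
  have hri : ∀ i, r i ≤ d := fun i =>
    (Finset.single_le_sum (f := r) (fun _ _ => Nat.zero_le _) (Finset.mem_univ i)).trans hr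
  simp_rw [← Finset.prod_mul_distrib]
  rw [expSet, Finset.sum_filter_of_ne]
  · rw [← Finset.prod_univ_sum (fun _ => Finset.range (d + 1))
      (fun i n => (He n).coeff (t i) / n.factorial * gL ((X : ℝ[X]) ^ (r i) * He n))]
    simp_rw [dual_one d _ _ (hri _)]
    rw [Finset.prod_ite_zero]
    simp [funext_iff]
  · intro n _ hne
    rw [Finset.prod_ne_zero_iff] at hne
    refine (Finset.sum_le_sum fun i _ => ?_).trans hr
    by_contra hlt
    refine hne i (Finset.mem_univ i) ?_
    rw [gL_He_lt _ _ (by simpa using hlt), mul_zero]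

theorem gsq_bound (l d : ℕ) (t : Fin l → ℕ) :
    ∑ m ∈ expSet l d, ∑ n ∈ expSet l d, ((∏ i, (He (m i)).coeff (t i) / (m i).factorial) *
      (∏ i, (He (n i)).coeff (t i) / (n i).factorial)) * ∏ i, gL (He (m i) * He (n i))
      ≤ ((l + d).choose d : ℝ) * d.factorial := by
  calc _ ≤ ∑ m ∈ expSet l d, (d.factorial : ℝ) := by
        refine Finset.sum_le_sum fun m hm => ?_
        rw [Finset.sum_eq_single m]
        · simp_rw [← Finset.prod_mul_distrib, gL_orth, if_true]
          have hm' : ∑ i, m i ≤ d := (Finset.mem_filter.1 hm).2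
          have h1 : (∏ i, (m i).factorial) ≤ d.factorial :=
            (Nat.le_of_dvd (Nat.factorial_pos _) (Nat.prod_factorial_dvd_factorial_sum _ _)).trans
              (Nat.factorial_le hm')
          refine le_trans (Finset.prod_le_prod (g := fun i => ((m i).factorial : ℝ)) ?_ ?_) ?_
          · intro i _
            rw [← sq]; positivity
          · intro i _
            have hp : (0 : ℝ) < (m i).factorial := by positivity
            have h2 : ((He (m i)).coeff (t i)) ^ 2 ≤ ((m i).factorial : ℝ) ^ 2 :=
              sq_le_sq' (abs_le.1 (coeff_He_le _ _)).1 (abs_le.1 (coeff_He_le _ _)).2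
            have h3 : (He (m i)).coeff (t i) / (m i).factorial *
                ((He (m i)).coeff (t i) / (m i).factorial) * (m i).factorial
                = ((He (m i)).coeff (t i)) ^ 2 / (m i).factorial := by
              field_simp
            rw [h3, div_le_iff₀ hp, ← sq]
            exact h2
          · exact_mod_cast h1
        · intro n _ hne
          obtain ⟨i, hi⟩ := Function.ne_iff.1 hne
          have hz : ∏ i, gL (He (m i) * He (n i)) = 0 :=
            Finset.prod_eq_zero (Finset.mem_univ i) (by rw [gL_orth, if_neg (Ne.symm hi)])
          rw [hz, mul_zero]
        · intro h; exact absurd hm h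
    _ ≤ _ := by
        rw [Finset.sum_const, nsmul_eq_mul]
        gcongr
        exact card_expSet l d

theorem cs_aux (A B N : ℝ) (hN : 0 ≤ N)
    (h : ∀ u : ℝ, 0 ≤ A - 2 * u * B + u ^ 2 * N) : B ^ 2 ≤ A * N := by
  by_cases h0 : N = 0
  · subst h0
    have h1 := h ((A + 1) / (2 * B))
    by_cases hb : B = 0
    · simp [hb]
    · have : 2 * ((A + 1) / (2 * B)) * B = A + 1 := by field_simp
      rw [this] at h1
      linarith
  · have hp : 0 < N := lt_of_le_of_ne hN (Ne.symm h0)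
    have h1 := h (B / N)
    have h2 : A - 2 * (B / N) * B + (B / N) ^ 2 * N = (A * N - B ^ 2) / N := by
      field_simp; ring
    rw [h2] at h1
    rw [le_div_iff₀ hp] at h1
    linarith

open Polynomial in
theorem main_bound (l d : ℕ) (c : Multiset (Fin l) →₀ ℝ)
    (hdeg : ∀ S ∈ c.support, Multiset.card S ≤ d)
    (T : Multiset (Fin l)) :
    (c T) ^ 2 ≤ (∫ x, (polyEval c x) ^ 2 ∂(stdGaussianPi l)) *
      (((l + d).choose d : ℝ) * d.factorial) := by
  set a : (Fin l → ℕ) → ℝ := fun n => ∏ i, (He (n i)).coeff (T.count i) / (n i).factorial with ha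
  set q : (Fin l → ℕ) → Fin l → ℝ[X] := fun n i => He (n i) with hq
  set p : Multiset (Fin l) → Fin l → ℝ[X] := fun S i => X ^ (S.count i) with hp
  set g : (Fin l → ℝ) → ℝ := fun x => ∑ n ∈ expSet l d, a n * PP (q n) x with hg
  have hf : ∀ x, polyEval c x = ∑ S ∈ c.support, c S * PP (p S) x := by
    intro x
    refine Finset.sum_congr rfl fun S _ => ?_
    simp only [PP, hp, eval_pow, eval_X]
    rw [Finset.prod_multiset_map_count]
    congr 1
    refine Finset.prod_subset (Finset.subset_univ _) fun i _ hi => ?_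
    rw [Multiset.count_eq_zero_of_notMem (by simpa using hi), pow_zero]
  have hfg : ∫ x, polyEval c x * g x ∂(stdGaussianPi l) = c T := by
    simp_rw [hf, hg]
    rw [integral_sum_mul_sum]
    have : ∀ S ∈ c.support, ∑ n ∈ expSet l d, c S * a n * ∏ i, gL (p S i * q n i)
        = if T = S then c S else 0 := by
      intro S hS
      have hdm := dual_multi l d (fun i => T.count i) (fun i => S.count i) (by
        refine le_of_eq_of_le ?_ (hdeg S hS)
        exact Multiset.sum_count_eq_card (fun i _ => Finset.mem_univ i))
      simp_rw [mul_assoc, ← Finset.mul_sum, ha, hp, hq]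
      rw [hdm]
      have : ((fun i => T.count i) = fun i => S.count i) ↔ T = S := by
        rw [Multiset.ext, funext_iff]
      simp [this]
    rw [Finset.sum_congr rfl this]
    simp only [Finset.sum_ite_eq, Finsupp.mem_support_iff]
    split_ifs with h
    · rfl
    · push Not at h; exact h.symm
  have hgg : ∫ x, g x * g x ∂(stdGaussianPi l) ≤ ((l + d).choose d : ℝ) * d.factorial := by
    simp_rw [hg]
    rw [integral_sum_mul_sum]
    exact gsq_bound l d _
  have iff' : Integrable (fun x => polyEval c x * polyEval c x) (stdGaussianPi l) := by
    simp_rw [hf]; exact integrable_sum_mul_sum _ _ _ _ _ _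
  have ifg : Integrable (fun x => polyEval c x * g x) (stdGaussianPi l) := by
    simp_rw [hf, hg]; exact integrable_sum_mul_sum _ _ _ _ _ _
  have igg : Integrable (fun x => g x * g x) (stdGaussianPi l) := by
    simp_rw [hg]; exact integrable_sum_mul_sum _ _ _ _ _ _
  have hA : 0 ≤ ∫ x, (polyEval c x) ^ 2 ∂(stdGaussianPi l) := integral_nonneg fun x => sq_nonneg _
  refine le_trans ?_ (mul_le_mul_of_nonneg_left hgg hA)
  rw [← hfg]
  have key : ∀ u : ℝ, 0 ≤ (∫ x, (polyEval c x) ^ 2 ∂(stdGaussianPi l))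
      - 2 * u * (∫ x, polyEval c x * g x ∂(stdGaussianPi l))
      + u ^ 2 * ∫ x, g x * g x ∂(stdGaussianPi l) := by
    intro u
    simp_rw [sq (polyEval c _)]
    have i3 : Integrable (fun x => polyEval c x * polyEval c x - 2 * u * (polyEval c x * g x))
      (stdGaussianPi l) := iff'.sub (ifg.const_mul _)
    rw [← integral_const_mul, ← integral_const_mul, ← integral_sub iff' (ifg.const_mul _),
      ← integral_add i3 (igg.const_mul _)]
    refine integral_nonneg fun x => ?_
    have : polyEval c x * polyEval c x - 2 * u * (polyEval c x * g x) + u ^ 2 * (g x * g x)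
        = (polyEval c x - u * g x) ^ 2 := by ring
    simp only [Pi.zero_apply]
    rw [this]
    positivity
  exact cs_aux _ _ _ (integral_nonneg fun x => mul_self_nonneg _) key

/-- Fact 3.4: for a degree-`d` polynomial `f` on `ℝ^l` and i.i.d. standard
Gaussians `𝒢`, every coefficient `c_T` satisfies
`‖f(𝒢)‖₂ ≥ d^{-d} · |c_T| / C(l+d, d)`. -/
theorem stmt2 (l d : ℕ) (c : Multiset (Fin l) →₀ ℝ)
    (hdeg : ∀ S ∈ c.support, Multiset.card S ≤ d)
    (T : Multiset (Fin l)) (hT : Multiset.card T ≤ d) :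
    (d : ℝ) ^ (-(d : ℤ)) * |c T| / (Nat.choose (l + d) d : ℝ) ≤
      Real.sqrt (∫ x, (polyEval c x) ^ 2 ∂(stdGaussianPi l)) := by
  refine Real.le_sqrt_of_sq_le ?_
  have h := main_bound l d c hdeg T
  set I := ∫ x, (polyEval c x) ^ 2 ∂(stdGaussianPi l) with hI
  have hI0 : 0 ≤ I := integral_nonneg fun x => sq_nonneg _
  have hC : (1 : ℝ) ≤ ((l + d).choose d : ℝ) := by
    exact_mod_cast Nat.choose_pos (Nat.le_add_left d l)
  have hD : (1 : ℝ) ≤ (d : ℝ) ^ d := by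
    have : 0 < d ^ d := by
      rcases Nat.eq_zero_or_pos d with h | h
      · subst h; simp
      · positivity
    exact_mod_cast this
  have hF : (d.factorial : ℝ) ≤ (d : ℝ) ^ d := by exact_mod_cast Nat.factorial_le_pow d
  rw [zpow_neg, zpow_natCast]
  set D := (d : ℝ) ^ d
  set K := ((l + d).choose d : ℝ)
  have h1 : (D⁻¹ * |c T| / K) ^ 2 = (c T) ^ 2 / (D * K) ^ 2 := by
    rw [← sq_abs (c T)]; field_simp
  rw [h1, div_le_iff₀ (by positivity)]
  refine h.trans (mul_le_mul_of_nonneg_left ?_ hI0)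
  have h2 : K * (d.factorial : ℝ) ≤ K * D := by gcongr
  have h3 : 1 ≤ D * K := one_le_mul_of_one_le_of_one_le hD hC
  nlinarith
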